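/- In the slack-allocation game with the linear clearing rule, for any fixed player j and any fixed nonnegative claims C_{−j} of the other players, the map x ↦ π_j(x) sending player j's own claim to their payoff is continuous on the interval [0, M]. -/

import Mathlib

/-- Overage of player `j`: `v j = max (C j - L j) 0`. -/
noncomputable def overage {n : ℕ} (L C : Fin n → ℝ) (j : Fin n) : ℝ :=
  max (C j - L j) 0

/-- Slack of player `j`: `s j = max (L j - C j) 0`. -/
noncomputable def slack {n : ℕ} (L C : Fin n → ℝ) (j : Fin n) : ℝ :=
  max (L j - C j) 0

/-- Aggregate overage `X = ∑ j, v j`. -/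
noncomputable def totOverage {n : ℕ} (L C : Fin n → ℝ) : ℝ :=
  ∑ j, overage L C j

/-- Aggregate slack `I = ∑ j, s j`. -/
noncomputable def totSlack {n : ℕ} (L C : Fin n → ℝ) : ℝ :=
  ∑ j, slack L C j

/-- Covered overage under the linear clearing rule:
`v̂ j = v j` if `X ≤ I`, and `v̂ j = (I / X) * v j` if `X > I`. -/
noncomputable def covered {n : ℕ} (L C : Fin n → ℝ) (j : Fin n) : ℝ :=
  if totOverage L C ≤ totSlack L C then overage L C j
  else (totSlack L C / totOverage L C) * overage L C j

/-- Payoff: `π j = C j` if `C j ≤ L j`, and `π j = L j + v̂ j` if `C j > L j`. -/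
noncomputable def payoff {n : ℕ} (L C : Fin n → ℝ) (j : Fin n) : ℝ :=
  if C j ≤ L j then C j else L j + covered L C j

section SlackAllocation

variable {n : ℕ} (L : Fin n → ℝ)

theorem overage_nonneg (C : Fin n → ℝ) (j : Fin n) : 0 ≤ overage L C j :=
  le_max_right _ _

theorem totSlack_nonneg (C : Fin n → ℝ) : 0 ≤ totSlack L C :=
  Finset.sum_nonneg fun _ _ => le_max_right _ _

theorem overage_le_totOverage (C : Fin n → ℝ) (j : Fin n) :
    overage L C j ≤ totOverage L C :=
  Finset.single_le_sum (fun i _ => overage_nonneg L C i) (Finset.mem_univ j)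

theorem continuous_overage (j : Fin n) : Continuous fun C => overage L C j := by
  unfold overage
  fun_prop

theorem continuous_totOverage : Continuous (totOverage L) :=
  continuous_finsetSum _ fun j _ => continuous_overage L j

theorem continuous_totSlack : Continuous (totSlack L) := by
  unfold totSlack slack
  fun_prop

theorem covered_eq_div_max (C : Fin n → ℝ) (j : Fin n) :
    covered L C j =
      totSlack L C / max (totOverage L C) (totSlack L C) * overage L C j := by
  unfold covered
  split_ifs with h
  · rw [max_eq_right h]
    rcases (totSlack_nonneg L C).eq_or_lt with h0 | h0
    · have : overage L C j = 0 :=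
        le_antisymm ((overage_le_totOverage L C j).trans (h.trans h0.ge)) (overage_nonneg L C j)
      simp [this]
    · rw [div_self h0.ne', one_mul]
  · rw [max_eq_left (not_le.1 h).le]

theorem covered_nonneg (C : Fin n → ℝ) (j : Fin n) : 0 ≤ covered L C j := by
  rw [covered_eq_div_max]
  exact mul_nonneg (div_nonneg (totSlack_nonneg L C)
    ((totSlack_nonneg L C).trans (le_max_right _ _))) (overage_nonneg L C j)

theorem covered_le_overage (C : Fin n → ℝ) (j : Fin n) : covered L C j ≤ overage L C j := by
  rw [covered_eq_div_max]
  exact mul_le_of_le_one_left (overage_nonneg L C j)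
    (div_le_one_of_le₀ (le_max_right _ _) ((totSlack_nonneg L C).trans (le_max_right _ _)))

theorem continuous_covered (j : Fin n) : Continuous fun C => covered L C j := by
  rw [continuous_iff_continuousAt]
  intro C
  by_cases h : max (totOverage L C) (totSlack L C) = 0
  · have hv : overage L C j = 0 :=
      le_antisymm ((overage_le_totOverage L C j).trans ((le_max_left _ _).trans h.le))
        (overage_nonneg L C j)
    have hc : covered L C j = 0 :=
      le_antisymm ((covered_le_overage L C j).trans hv.le) (covered_nonneg L C j)
    have ht := (continuous_overage L j).tendsto C
    rw [hv] at ht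
    rw [ContinuousAt, hc]
    exact squeeze_zero (fun C => covered_nonneg L C j) (fun C => covered_le_overage L C j) ht
  · simp only [covered_eq_div_max]
    exact ((continuous_totSlack L).continuousAt.div
      ((continuous_totOverage L).max (continuous_totSlack L)).continuousAt h).mul
      (continuous_overage L j).continuousAt

theorem payoff_eq_min_add_covered (C : Fin n → ℝ) (j : Fin n) :
    payoff L C j = min (C j) (L j) + covered L C j := by
  unfold payoff
  split_ifs with h
  · have hv : overage L C j = 0 := max_eq_right (sub_nonpos.2 h)
    simp [covered_eq_div_max, hv, h]
  · rw [min_eq_right (not_le.1 h).le]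

theorem continuous_payoff (j : Fin n) : Continuous fun C => payoff L C j := by
  simp only [payoff_eq_min_add_covered]
  exact ((continuous_apply j).min continuous_const).add (continuous_covered L j)

end SlackAllocation

/-- For fixed `j` and fixed nonnegative claims of the others, the map
`x ↦ π_j(x)` is continuous on `[0, M]`. -/
theorem payoff_continuousOn_own_claim {n : ℕ} (M : ℝ) (hM : 0 < M)
    (L C : Fin n → ℝ) (hL : ∀ i, 0 < L i) (j : Fin n)
    (hC : ∀ i, i ≠ j → 0 ≤ C i) :
    ContinuousOn (fun x : ℝ => payoff L (Function.update C j x) j) (Set.Icc 0 M) :=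
  ((continuous_payoff L j).comp (continuous_const.update j continuous_id)).continuousOn
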